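/- arXiv:2512.17606 — 3 statements merged into one kernel-verified Lean document; each statement's English description precedes it below -/
import Mathlib

section
/- Let A ⊆ ℝ^d have positive reach and 0 < r < reach A. Then the map a ↦ span(Tan(A,a)) is (1/r)-Lipschitz on T₁(A) = {a ∈ A : dim Tan(A,a) = 1}, with respect to the metric ρ₁ on the space of lines through the origin, where ρ₁(U,V) = sup_{u∈U,|u|=1} dist(u,V). -/
open Metric Set MeasureTheory
open scoped RealInnerProductSpace ENNReal NNReal

noncomputable section

abbrev Euc (d : ℕ) := EuclideanSpace ℝ (Fin d)

/-- Points of the ambient space having a unique nearest point in `A`. -/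
def unp {d : ℕ} (A : Set (Euc d)) : Set (Euc d) :=
  {x | ∃! a, a ∈ A ∧ dist x a = Metric.infDist x A}

/-- Federer's local reach `reach (A, a)`. -/
def reachAt {d : ℕ} (A : Set (Euc d)) (a : Euc d) : ℝ≥0∞ :=
  sSup {r : ℝ≥0∞ | ∀ x : Euc d, edist x a < r → x ∈ unp A}

/-- Federer's reach of a set. -/
def reach {d : ℕ} (A : Set (Euc d)) : ℝ≥0∞ := ⨅ a ∈ A, reachAt A a

/-- The tangent cone of `A` at `a`: `u` is a tangent vector iff `u = 0` or `u` is a limit of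
`r i • (x i - a)` with `x i ∈ A \ {a}`, `x i → a`, `r i > 0`. -/
def tanCone {d : ℕ} (A : Set (Euc d)) (a : Euc d) : Set (Euc d) :=
  {u | u = 0 ∨ ∃ (x : ℕ → Euc d) (r : ℕ → ℝ),
    (∀ n, x n ∈ A ∧ x n ≠ a) ∧
    Filter.Tendsto x Filter.atTop (nhds a) ∧
    (∀ n, 0 < r n) ∧
    Filter.Tendsto (fun n => r n • (x n - a)) Filter.atTop (nhds u)}

/-- The dimension of the tangent cone of `A` at `a`. -/
def tanDim {d : ℕ} (A : Set (Euc d)) (a : Euc d) : ℕ :=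
  Module.finrank ℝ (Submodule.span ℝ (tanCone A a))

/-- The set of points of `A` at which the tangent cone has dimension `k`. -/
def Tk {d : ℕ} (A : Set (Euc d)) (k : ℕ) : Set (Euc d) :=
  {x | x ∈ A ∧ tanDim A x = k}

/-- Whitney's fullness `Θ(σ) = vol_k(σ) / (diam σ)^k` of a set. -/
def fullness {d : ℕ} (k : ℕ) (s : Set (Euc d)) : ℝ :=
  (μH[(k : ℝ)] s).toReal / (Metric.diam s) ^ k

/-- The metric `ρ_k` on the Grassmannian of subspaces of `ℝ^d`. -/
def grassDist {d : ℕ} (U V : Submodule ℝ (Euc d)) : ℝ :=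
  max (sSup ((fun u => Metric.infDist u (V : Set (Euc d))) '' {u | u ∈ U ∧ ‖u‖ = 1}))
      (sSup ((fun v => Metric.infDist v (U : Set (Euc d))) '' {v | v ∈ V ∧ ‖v‖ = 1}))

lemma mem_unp_of_dist_le {d : ℕ} {A : Set (Euc d)} {r : ℝ}
    (hrA : ENNReal.ofReal r < reach A) {p x : Euc d} (hp : p ∈ A) (h : dist x p ≤ r) :
    x ∈ unp A := by
  have h1 : ENNReal.ofReal r < reachAt A p := hrA.trans_le (iInf₂_le p hp)
  obtain ⟨s, hs, hrs⟩ := lt_sSup_iff.1 h1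
  refine hs x (lt_of_le_of_lt ?_ hrs)
  rw [edist_dist]
  exact ENNReal.ofReal_le_ofReal h

lemma isClosed_of_lt_reach {d : ℕ} {A : Set (Euc d)} {r : ℝ} (hr : 0 < r)
    (hrA : ENNReal.ofReal r < reach A) : IsClosed A := by
  refine isClosed_of_closure_subset fun q hq => ?_
  obtain ⟨p, hp, hqp⟩ := Metric.mem_closure_iff.1 hq r hr
  obtain ⟨a, ⟨ha, hqa⟩, -⟩ := mem_unp_of_dist_le hrA hp hqp.le
  rw [(Metric.mem_closure_iff_infDist_zero ⟨p, hp⟩).1 hq, dist_eq_zero] at hqa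
  exact hqa ▸ ha

/-- At a point with a unique nearest point, the distance to a closed set increases with
slope at least any `c < 1` along the direction pointing away from the nearest point. -/
lemma exists_infDist_add_le {d : ℕ} {A : Set (Euc d)} (hA : IsClosed A) {y : Euc d}
    (hy : y ∈ unp A) (hpos : 0 < infDist y A) {c : ℝ} (hc0 : 0 ≤ c) (hc : c < 1)
    {η : ℝ} (hη : 0 < η) :
    ∃ y' : Euc d, y' ≠ y ∧ dist y' y < η ∧ infDist y A + c * dist y' y ≤ infDist y' A := by
  obtain ⟨ξ, ⟨hξA, hξ⟩, huniq⟩ := hy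
  have hne : A.Nonempty := ⟨ξ, hξA⟩
  set δ := infDist y A with hδ
  set ν : Euc d := δ⁻¹ • (y - ξ) with hν
  have hnorm : ‖y - ξ‖ = δ := by rw [← dist_eq_norm, hξ]
  have hν1 : ‖ν‖ = 1 := by
    rw [hν, norm_smul, hnorm, Real.norm_of_nonneg (by positivity), inv_mul_cancel₀ hpos.ne']
  by_contra! H
  let h : ℕ → ℝ := fun k => (1 / ((k : ℝ) + 1)) * (η / 2)
  have hpos_h : ∀ k, 0 < h k := fun k => by positivity
  have hlt_h : ∀ k, h k < η := fun k => by
    have : (1 / ((k : ℝ) + 1)) ≤ 1 := by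
      rw [div_le_one (by positivity)]; linarith [Nat.cast_nonneg (α := ℝ) k]
    have := mul_le_mul_of_nonneg_right this (by positivity : 0 ≤ η / 2)
    simp only [h]; linarith
  have hlim_h : Filter.Tendsto h Filter.atTop (nhds 0) := by
    simpa [h] using (tendsto_one_div_add_atTop_nhds_zero_nat (𝕜 := ℝ)).mul_const (η / 2)
  have hdist : ∀ k, dist (y + h k • ν) y = h k := fun k => by
    rw [dist_eq_norm, add_sub_cancel_left, norm_smul, hν1, mul_one,
      Real.norm_of_nonneg (hpos_h k).le]
  have hnear : ∀ k, ∃ p ∈ A, infDist (y + h k • ν) A = dist (y + h k • ν) p := fun k =>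
    hA.exists_infDist_eq_dist hne _
  choose p hpA hp using hnear
  have hup : ∀ k, dist (y + h k • ν) (p k) < δ + c * h k := fun k => by
    have := H (y + h k • ν) (fun e => by
      have := hdist k; rw [e, dist_self] at this; exact (hpos_h k).ne this)
      (by rw [hdist]; exact hlt_h k)
    rwa [hdist, hp] at this
  have hinner : ∀ k, ⟪y - p k, ν⟫ < c * δ := fun k => by
    have h1 : δ ≤ ‖y - p k‖ := by rw [← dist_eq_norm]; exact infDist_le_dist_of_mem (hpA k)
    have h2 := hup k
    rw [dist_eq_norm, show y + h k • ν - p k = (y - p k) + h k • ν by abel] at h2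
    have h3 : ‖(y - p k) + h k • ν‖ ^ 2 < (δ + c * h k) ^ 2 := by gcongr
    rw [norm_add_sq_real, inner_smul_right, norm_smul, hν1, mul_one, Real.norm_eq_abs,
      sq_abs] at h3
    have h4 : δ ^ 2 ≤ ‖y - p k‖ ^ 2 := by gcongr
    have h5 := hpos_h k
    have h6 : c ^ 2 * h k ^ 2 ≤ 1 * h k ^ 2 := by
      gcongr
      nlinarith
    have h7 : h k * ⟪y - p k, ν⟫ < h k * (c * δ) := by nlinarith
    exact lt_of_mul_lt_mul_left h7 h5.le
  have hbdd : ∀ k, p k ∈ closedBall y (δ + 2 * η) := fun k => by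
    rw [mem_closedBall']
    have h1 := dist_triangle y (y + h k • ν) (p k)
    rw [dist_comm y (y + h k • ν), hdist] at h1
    nlinarith [hup k, hlt_h k, hpos_h k]
  obtain ⟨q, -, φ, hφ, hq⟩ := (isCompact_closedBall y (δ + 2 * η)).tendsto_subseq hbdd
  have hhφ := hlim_h.comp hφ.tendsto_atTop
  have hqA : q ∈ A := hA.mem_of_tendsto hq (Filter.Eventually.of_forall fun k => hpA _)
  have hyq : dist y q ≤ δ := by
    have l1 : Filter.Tendsto (fun k => dist (y + h (φ k) • ν) (p (φ k))) Filter.atTop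
        (nhds (dist (y + (0 : ℝ) • ν) q)) :=
      (tendsto_const_nhds.add (hhφ.smul_const ν)).dist hq
    have l2 : Filter.Tendsto (fun k => δ + c * h (φ k)) Filter.atTop (nhds (δ + c * 0)) :=
      tendsto_const_nhds.add (hhφ.const_mul c)
    have := le_of_tendsto_of_tendsto' l1 l2 fun k => (hup _).le
    simpa using this
  have hqξ : q = ξ := huniq q ⟨hqA, le_antisymm hyq (infDist_le_dist_of_mem hqA)⟩
  have hlim : ⟪y - q, ν⟫ ≤ c * δ :=
    le_of_tendsto' ((tendsto_const_nhds.sub hq).inner tendsto_const_nhds)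
      fun k => (hinner (φ k)).le
  rw [hqξ, hν, inner_smul_right, real_inner_self_eq_norm_sq, hnorm] at hlim
  have : δ⁻¹ * δ ^ 2 = δ := by field_simp
  nlinarith

/-- If all points of the closed ball of radius `s` around `x` have a unique nearest point in
`A`, then the distance to `A` grows with slope one on the ball along the normal ray of `x`. -/
lemma infDist_extend_normal {d : ℕ} {A : Set (Euc d)} (hA : IsClosed A) {x p : Euc d}
    (hp : p ∈ A) (hxp : dist x p = infDist x A) (hpos : 0 < dist x p) {s : ℝ} (hs : 0 ≤ s)
    (hball : closedBall x s ⊆ unp A) :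
    infDist (p + (dist x p + s) • (dist x p)⁻¹ • (x - p)) A = dist x p + s := by
  have hcont : Continuous fun y : Euc d => infDist y A := continuous_infDist_pt A
  have hcomp := isCompact_closedBall x s
  have hxmem : x ∈ closedBall x s := mem_closedBall_self hs
  obtain ⟨y, hy, hmax⟩ := hcomp.exists_isMaxOn ⟨x, hxmem⟩ hcont.continuousOn
  have hgrow : ∀ c : ℝ, 0 ≤ c → c < 1 → infDist x A + c * s ≤ infDist y A := by
    intro c hc0 hc
    obtain ⟨z, hz, hzmax⟩ := hcomp.exists_isMaxOn (f := fun y => infDist y A - c * dist y x)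
      ⟨x, hxmem⟩ (by fun_prop)
    have hzx : infDist x A + c * dist z x ≤ infDist z A := by
      have := hzmax hxmem
      simp only [mem_ofPred_eq, dist_self] at this
      linarith
    rcases (mem_closedBall.1 hz).eq_or_lt with e | hlt
    · rw [e] at hzx
      exact hzx.trans (hmax hz)
    · exfalso
      have hzpos : 0 < infDist z A := by
        have : 0 ≤ c * dist z x := by positivity
        linarith
      obtain ⟨z', hne, hz', hle⟩ := exists_infDist_add_le hA (hball hz) hzpos
        (c := (c + 1) / 2) (by linarith) (by linarith) (sub_pos.2 hlt)
      have htri := dist_triangle z' z x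
      have := hzmax (show z' ∈ closedBall x s by rw [mem_closedBall]; linarith)
      simp only [mem_ofPred_eq] at this
      have hd := dist_pos.2 hne
      nlinarith
  have hyge : infDist x A + s ≤ infDist y A := by
    by_contra! hlt
    have hspos : 0 < s := by
      have := hmax hxmem
      simp only [mem_ofPred_eq] at this
      linarith
    have h0 := hgrow 0 le_rfl one_pos
    set g := (infDist y A - infDist x A) / s with hg
    have hgs : g * s = infDist y A - infDist x A := by rw [hg]; field_simp
    have hg0 : 0 ≤ g := by rw [hg]; apply div_nonneg <;> linarith
    have hg1 : g < 1 := by rw [hg, div_lt_one hspos]; linarith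
    have := hgrow ((g + 1) / 2) (by linarith) (by linarith)
    nlinarith
  have hyp : infDist y A ≤ dist y p := infDist_le_dist_of_mem hp
  have hyx : dist y x ≤ s := hy
  have htri := dist_triangle y x p
  have hyxs : dist y x = s := by linarith
  have hypx : dist y p = dist x p + s := by linarith
  have hyA : infDist y A = dist x p + s := by linarith
  have hray : SameRay ℝ (x - p) (y - x) := by
    rw [sameRay_iff_norm_add, ← dist_eq_norm, ← dist_eq_norm,
      show x - p + (y - x) = y - p by abel, ← dist_eq_norm, hypx, hyxs]
  rw [sameRay_iff_norm_smul_eq, ← dist_eq_norm, ← dist_eq_norm, hyxs] at hray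
  have hyeq : p + (dist x p + s) • (dist x p)⁻¹ • (x - p) = y := by
    have h1 : y - x = (dist x p)⁻¹ • s • (x - p) := by
      rw [← hray, smul_smul, inv_mul_cancel₀ hpos.ne', one_smul]
    rw [add_smul, smul_smul, mul_inv_cancel₀ hpos.ne', one_smul, smul_comm, ← h1]
    abel
  rw [hyeq, hyA]

/-- Directions of points of `A` close to `a` are almost orthogonal to the normal `n`. -/
lemma exists_inner_le_of_normal {d : ℕ} {A : Set (Euc d)} {a n : Euc d}
    (hn : ∀ u ∈ tanCone A a, ⟪u, n⟫ ≤ 0) {ε : ℝ} (hε : 0 < ε) :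
    ∃ η > 0, ∀ q ∈ A, dist q a < η → ⟪q - a, n⟫ ≤ ε * ‖q - a‖ := by
  by_contra! H
  choose q hqA hqa hq using fun k : ℕ => H (1 / ((k : ℝ) + 1)) (by positivity)
  have hne : ∀ k, q k ≠ a := fun k e => by simpa [e] using hq k
  have hpos : ∀ k, 0 < ‖q k - a‖ := fun k => norm_pos_iff.2 (sub_ne_zero.2 (hne k))
  have hlim : Filter.Tendsto q Filter.atTop (nhds a) := by
    rw [tendsto_iff_dist_tendsto_zero]
    exact squeeze_zero (fun _ => dist_nonneg) (fun k => (hqa k).le)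
      tendsto_one_div_add_atTop_nhds_zero_nat
  obtain ⟨u, -, φ, hφ, hu⟩ := (isCompact_sphere (0 : Euc d) 1).tendsto_subseq
    (x := fun k => ‖q k - a‖⁻¹ • (q k - a)) (fun k => by
      rw [mem_sphere_zero_iff_norm, norm_smul, norm_inv, norm_norm, inv_mul_cancel₀ (hpos k).ne'])
  have hmem : u ∈ tanCone A a := Or.inr ⟨fun k => q (φ k), fun k => ‖q (φ k) - a‖⁻¹,
    fun k => ⟨hqA _, hne _⟩, hlim.comp hφ.tendsto_atTop, fun k => inv_pos.2 (hpos _), hu⟩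
  have hle : ε ≤ ⟪u, n⟫ := ge_of_tendsto' (hu.inner tendsto_const_nhds) fun k => by
    simp only [Function.comp, real_inner_smul_left]
    have := hq (φ k)
    rw [inv_mul_eq_div, le_div_iff₀ (hpos _)]
    exact this.le
  linarith [hn u hmem]

/-- The open ball of radius `r` tangent to `A` at `a` with unit normal `n` contains no
point of `A`. -/
lemma le_dist_of_normal {d : ℕ} {A : Set (Euc d)} {r : ℝ} (hr : 0 < r)
    (hrA : ENNReal.ofReal r < reach A) {a n : Euc d} (ha : a ∈ A) (hn1 : ‖n‖ = 1)
    (hn : ∀ u ∈ tanCone A a, ⟪u, n⟫ ≤ 0) {b : Euc d} (hb : b ∈ A) :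
    r ≤ dist (a + r • n) b := by
  have hA := isClosed_of_lt_reach hr hrA
  let t : ℕ → ℝ := fun k => (1 / ((k : ℝ) + 1)) * r
  have htpos : ∀ k, 0 < t k := fun k => by positivity
  have htle : ∀ k, t k ≤ r := fun k => by
    have : (1 / ((k : ℝ) + 1)) ≤ 1 := by
      rw [div_le_one (by positivity)]; linarith [Nat.cast_nonneg (α := ℝ) k]
    have := mul_le_mul_of_nonneg_right this hr.le
    simp only [t]; linarith
  have htlim : Filter.Tendsto t Filter.atTop (nhds 0) := by
    simpa [t] using (tendsto_one_div_add_atTop_nhds_zero_nat (𝕜 := ℝ)).mul_const r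
  have hdist : ∀ k, dist (a + t k • n) a = t k := fun k => by
    rw [dist_eq_norm, add_sub_cancel_left, norm_smul, hn1, mul_one,
      Real.norm_of_nonneg (htpos k).le]
  choose p hpA hp using fun k => hA.exists_infDist_eq_dist ⟨a, ha⟩ (a + t k • n)
  have hple : ∀ k, dist (a + t k • n) (p k) ≤ t k := fun k => by
    rw [← hp]; exact (infDist_le_dist_of_mem ha).trans_eq (hdist k)
  have hpa : ∀ k, dist (p k) a ≤ 2 * t k := fun k => by
    have := dist_triangle (p k) (a + t k • n) a
    rw [dist_comm (p k) (a + t k • n), hdist] at this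
    linarith [hple k]
  have hsq : ∀ k, ‖p k - a‖ ^ 2 ≤ 2 * t k * ⟪p k - a, n⟫ := fun k => by
    have h1 := hple k
    rw [dist_comm, dist_eq_norm, show p k - (a + t k • n) = (p k - a) - t k • n by abel] at h1
    have h2 : ‖(p k - a) - t k • n‖ ^ 2 ≤ t k ^ 2 := by gcongr
    rw [norm_sub_sq_real, inner_smul_right, norm_smul, hn1, mul_one, Real.norm_eq_abs,
      sq_abs] at h2
    linarith
  have hplim : Filter.Tendsto p Filter.atTop (nhds a) := by
    rw [tendsto_iff_dist_tendsto_zero]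
    exact squeeze_zero (fun _ => dist_nonneg) hpa (by simpa using htlim.const_mul 2)
  have hsmall : Filter.Tendsto (fun k => (t k)⁻¹ • (p k - a)) Filter.atTop (nhds 0) := by
    rw [Metric.tendsto_nhds]
    intro ε hε
    obtain ⟨η, hη, hq⟩ := exists_inner_le_of_normal hn (show 0 < ε / 4 by positivity)
    filter_upwards [hplim.eventually (Metric.ball_mem_nhds a hη)] with k hk
    have h1 := hq (p k) (hpA k) hk
    have h2 := hsq k
    have h3 := htpos k
    rw [dist_zero_right, norm_smul, norm_inv, Real.norm_of_nonneg h3.le, inv_mul_eq_div,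
      div_lt_iff₀ h3]
    by_contra! h4
    have h5 : 0 < ‖p k - a‖ := lt_of_lt_of_le (by positivity) h4
    have h6 := mul_le_mul_of_nonneg_left h1 (by positivity : 0 ≤ 2 * t k)
    have h7 : ‖p k - a‖ ≤ ε * t k / 2 := by
      refine le_of_mul_le_mul_left ?_ h5
      nlinarith
    have : 0 < ε * t k := by positivity
    linarith
  -- rescaled offsets from the nearest points
  let w : ℕ → Euc d := fun k => n - (t k)⁻¹ • (p k - a)
  have hwlim : Filter.Tendsto w Filter.atTop (nhds n) := by
    simpa using hsmall.const_sub n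
  have hw : ∀ k, a + t k • n - p k = t k • w k := fun k => by
    simp only [w, smul_sub, smul_smul, mul_inv_cancel₀ (htpos k).ne', one_smul]
    abel
  have hwnorm : Filter.Tendsto (fun k => ‖w k‖) Filter.atTop (nhds 1) := hn1 ▸ hwlim.norm
  have hlim : Filter.Tendsto (fun k => dist (p k + r • ‖w k‖⁻¹ • w k) b) Filter.atTop
      (nhds (dist (a + r • (1 : ℝ)⁻¹ • n) b)) :=
    (hplim.add (((hwnorm.inv₀ one_ne_zero).smul hwlim).const_smul r)).dist tendsto_const_nhds
  rw [inv_one, one_smul] at hlim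
  refine ge_of_tendsto hlim ?_
  filter_upwards [hwnorm.eventually (lt_mem_nhds one_pos)] with k hk
  have hd : dist (a + t k • n) (p k) = t k * ‖w k‖ := by
    rw [dist_eq_norm, hw, norm_smul, Real.norm_of_nonneg (htpos k).le]
  have hdpos : 0 < dist (a + t k • n) (p k) := by rw [hd]; exact mul_pos (htpos k) hk
  have hext := infDist_extend_normal hA (hpA k) (hp k).symm hdpos
    (s := r - dist (a + t k • n) (p k)) (by linarith [hple k, htle k]) (fun y hy => by
      refine mem_unp_of_dist_le hrA (hpA k) ?_
      have := dist_triangle y (a + t k • n) (p k)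
      linarith [mem_closedBall.1 hy])
  have hdir : (dist (a + t k • n) (p k))⁻¹ • (a + t k • n - p k) = ‖w k‖⁻¹ • w k := by
    rw [hd, hw, smul_smul, mul_inv, mul_right_comm, inv_mul_cancel₀ (htpos k).ne', one_mul]
  rw [hdir, add_sub_cancel] at hext
  exact hext.symm.le.trans (infDist_le_dist_of_mem hb)

/-- Federer's inequality for the span of the tangent cone. -/
lemma exists_mem_span_tanCone_norm_sub_le {d : ℕ} {A : Set (Euc d)} {r : ℝ} (hr : 0 < r)
    (hrA : ENNReal.ofReal r < reach A) {a b : Euc d} (ha : a ∈ A) (hb : b ∈ A) :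
    ∃ v ∈ Submodule.span ℝ (tanCone A a), ‖(b - a) - v‖ ≤ ‖b - a‖ ^ 2 / (2 * r) := by
  set U := Submodule.span ℝ (tanCone A a) with hU
  set v := U.starProjection (b - a) with hv
  have hvU : v ∈ U := U.starProjection_apply_mem _
  refine ⟨v, hvU, ?_⟩
  have horth : ∀ u ∈ U, ⟪b - a - v, u⟫ = 0 := fun u hu =>
    U.starProjection_inner_eq_zero (b - a) u hu
  rcases eq_or_ne (b - a - v) 0 with h0 | h0
  · rw [h0, norm_zero]; positivity
  have hpos : 0 < ‖b - a - v‖ := norm_pos_iff.2 h0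
  set n : Euc d := ‖b - a - v‖⁻¹ • (b - a - v) with hn
  have hn1 : ‖n‖ = 1 := by rw [hn, norm_smul, norm_inv, norm_norm, inv_mul_cancel₀ hpos.ne']
  have hinner : ⟪b - a, n⟫ = ‖b - a - v‖ := by
    have h1 : ⟪b - a, b - a - v⟫ = ‖b - a - v‖ ^ 2 := by
      conv_lhs => rw [show b - a = (b - a - v) + v by abel]
      rw [add_sub_cancel_right, inner_add_left, real_inner_self_eq_norm_sq, real_inner_comm,
        horth v hvU, add_zero]
    rw [hn, inner_smul_right, h1]
    field_simp
  have hball := le_dist_of_normal hr hrA ha hn1 (fun u hu => by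
    rw [hn, inner_smul_right, real_inner_comm, horth u (Submodule.subset_span hu), mul_zero]) hb
  rw [dist_comm, dist_eq_norm, show b - (a + r • n) = (b - a) - r • n by abel] at hball
  have h2 : r ^ 2 ≤ ‖(b - a) - r • n‖ ^ 2 := by gcongr
  rw [norm_sub_sq_real, inner_smul_right, norm_smul, hn1, mul_one, Real.norm_eq_abs,
    sq_abs, hinner] at h2
  rw [le_div_iff₀ (by positivity)]
  linarith

/-- For a line `U` and any subspace `V`, the deviation of `U` from `V` is controlled by the
deviations of a single nonzero vector from `U` and from `V`. -/
lemma norm_mul_infDist_le {E : Type*} [NormedAddCommGroup E] [InnerProductSpace ℝ E]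
    {U V : Submodule ℝ E} (hU : Module.finrank ℝ U = 1) {u z x y : E} (hu : u ∈ U)
    (hu1 : ‖u‖ = 1) (hx : x ∈ U) (hy : y ∈ V) :
    ‖z‖ * infDist u (V : Set E) ≤ ‖z - x‖ + ‖z - y‖ := by
  rcases eq_or_ne z 0 with rfl | hz
  · simp only [norm_zero, zero_mul]; positivity
  have hzpos : 0 < ‖z‖ := norm_pos_iff.2 hz
  have hu0 : (⟨u, hu⟩ : U) ≠ 0 := fun h => by
    have : u = 0 := congrArg Subtype.val h
    simp [this] at hu1
  obtain ⟨c, hc⟩ := (finrank_eq_one_iff_of_nonzero' (⟨u, hu⟩ : U) hu0).1 hU ⟨x, hx⟩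
  have hc' : c • u = x := congrArg Subtype.val hc
  set α := ⟪z, u⟫ with hα
  have hαle : |α| ≤ ‖z‖ := by simpa [hu1] using abs_real_inner_le_norm z u
  -- the defect of `u` from the line through `z` is at most that of `z` from `U`
  have h1 : ‖‖z‖ • u - (α / ‖z‖) • z‖ ≤ ‖z - x‖ := by
    refine le_of_sq_le_sq ?_ (norm_nonneg _)
    rw [← hc', norm_sub_sq_real, norm_sub_sq_real]
    simp only [inner_smul_left, inner_smul_right, norm_smul, hu1, real_inner_comm z u, ← hα,
      Real.norm_eq_abs, abs_norm, mul_one, sq_abs, mul_pow, RCLike.conj_to_real]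
    have : (α / ‖z‖) ^ 2 * ‖z‖ ^ 2 = α ^ 2 := by field_simp
    have h' : α / ‖z‖ * (‖z‖ * α) = α ^ 2 := by field_simp
    nlinarith [sq_nonneg (c - α)]
  have h2 : ‖(α / ‖z‖) • (z - y)‖ ≤ ‖z - y‖ := by
    rw [norm_smul, Real.norm_eq_abs, abs_div, abs_norm]
    exact mul_le_of_le_one_left (norm_nonneg _) ((div_le_one hzpos).2 hαle)
  have h3 : infDist u (V : Set E) ≤ dist u (‖z‖⁻¹ • (α / ‖z‖) • y) :=
    infDist_le_dist_of_mem (V.smul_mem _ (V.smul_mem _ hy))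
  calc ‖z‖ * infDist u (V : Set E) ≤ ‖z‖ * dist u (‖z‖⁻¹ • (α / ‖z‖) • y) := by gcongr
    _ = ‖‖z‖ • u - (α / ‖z‖) • y‖ := by
        rw [dist_eq_norm, ← norm_norm z, ← norm_smul, norm_norm, smul_sub, smul_smul ‖z‖ ‖z‖⁻¹,
          mul_inv_cancel₀ hzpos.ne', one_smul]
    _ = ‖(‖z‖ • u - (α / ‖z‖) • z) + (α / ‖z‖) • (z - y)‖ := by
        congr 1; rw [smul_sub]; abel
    _ ≤ ‖z - x‖ + ‖z - y‖ := (norm_add_le _ _).trans (add_le_add h1 h2)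

lemma infDist_span_tanCone_le {d : ℕ} {A : Set (Euc d)} {r : ℝ} (hr : 0 < r)
    (hrA : ENNReal.ofReal r < reach A) {a b : Euc d} (ha : a ∈ Tk A 1) (hb : b ∈ A)
    {u : Euc d} (hu : u ∈ Submodule.span ℝ (tanCone A a)) (hu1 : ‖u‖ = 1) :
    infDist u (Submodule.span ℝ (tanCone A b) : Set (Euc d)) ≤ (1 / r) * dist a b := by
  rcases eq_or_ne a b with rfl | hab
  · rw [infDist_zero_of_mem hu, dist_self, mul_zero]
  obtain ⟨x, hx, hxle⟩ := exists_mem_span_tanCone_norm_sub_le hr hrA ha.1 hb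
  obtain ⟨y, hy, hyle⟩ := exists_mem_span_tanCone_norm_sub_le hr hrA hb ha.1
  have hpos : 0 < ‖b - a‖ := norm_pos_iff.2 (sub_ne_zero.2 hab.symm)
  have h := norm_mul_infDist_le (z := b - a) ha.2 hu hu1 hx (Submodule.neg_mem _ hy)
  rw [show b - a - -y = -(a - b - y) by abel, norm_neg] at h
  rw [norm_sub_rev a b] at hyle
  rw [dist_comm, dist_eq_norm]
  refine le_of_mul_le_mul_left (h.trans ((add_le_add hxle hyle).trans_eq ?_)) hpos
  field_simp
  ring

theorem stmt10 {d : ℕ} (A : Set (Euc d)) (hA : 0 < reach A) (r : ℝ) (hr : 0 < r)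
    (hrA : ENNReal.ofReal r < reach A) :
    ∀ a ∈ Tk A 1, ∀ b ∈ Tk A 1,
      grassDist (Submodule.span ℝ (tanCone A a)) (Submodule.span ℝ (tanCone A b)) ≤
        (1 / r) * dist a b := by
  intro a ha b hb
  have hnonneg : 0 ≤ (1 / r) * dist a b := by positivity
  refine max_le (Real.sSup_le ?_ hnonneg) (Real.sSup_le ?_ hnonneg)
  · rintro _ ⟨u, ⟨hu, hu1⟩, rfl⟩
    exact infDist_span_tanCone_le hr hrA ha hb.1 hu hu1
  · rintro _ ⟨v, ⟨hv, hv1⟩, rfl⟩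
    rw [dist_comm]
    exact infDist_span_tanCone_le hr hrA hb ha.1 hv hv1
end
end

section
/- Let A ⊆ ℝ^d have positive reach and let 1 ≤ k ≤ d. Then the set T_k(A) of points of A where the tangent cone has dimension k is disjoint from the closure of the union ⋃_{i=0}^{k−1} T_i(A). In particular, T₁(A) is a closed subset of ℝ^d. -/
open Metric Set MeasureTheory
open scoped RealInnerProductSpace ENNReal NNReal

noncomputable section

open Filter Topology

theorem mem_tanCone_of_tendsto {d : ℕ} {A : Set (Euc d)} {a u : Euc d} {x : ℕ → Euc d}
    {r : ℕ → ℝ} (hxA : ∀ n, x n ∈ A) (hx : Tendsto x atTop (𝓝 a)) (hr : ∀ n, 0 < r n)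
    (hu : Tendsto (fun n => r n • (x n - a)) atTop (𝓝 u)) : u ∈ tanCone A a := by
  by_cases h0 : u = 0
  · exact Or.inl h0
  obtain ⟨N, hN⟩ := eventually_atTop.1 (hu.eventually_ne h0)
  refine Or.inr ⟨fun n => x (n + N), fun n => r (n + N), fun n => ⟨hxA _, fun h => ?_⟩,
    hx.comp (tendsto_add_atTop_nat N), fun n => hr _, hu.comp (tendsto_add_atTop_nat N)⟩
  exact hN (n + N) (by omega) (by rw [show x (n + N) = a from h]; simp)

theorem smul_mem_tanCone {d : ℕ} {A : Set (Euc d)} {a u : Euc d} (hu : u ∈ tanCone A a)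
    {c : ℝ} (hc : 0 < c) : c • u ∈ tanCone A a := by
  rcases hu with rfl | ⟨x, r, hxA, hx, hr, hu⟩
  · left; simp
  · refine mem_tanCone_of_tendsto (r := fun n => c * r n) (fun n => (hxA n).1) hx
      (fun n => mul_pos hc (hr n)) ?_
    simpa [mul_smul] using hu.const_smul c

/-- A set of positive reach has a tubular neighbourhood of points with unique nearest points. -/
theorem exists_tube_subset_unp {d : ℕ} {A : Set (Euc d)} (hA : 0 < reach A) (hne : A.Nonempty) :
    ∃ ρ : ℝ, 0 < ρ ∧ ∀ x, infDist x A < ρ → x ∈ unp A := by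
  obtain ⟨ρ, hρ0, hρ⟩ := ENNReal.lt_iff_exists_nnreal_btwn.1 hA
  refine ⟨ρ, by exact_mod_cast hρ0, fun x hx => ?_⟩
  obtain ⟨a, haA, hxa⟩ := (infDist_lt_iff hne).1 hx
  have h1 : edist x a < reachAt A a := by
    refine lt_of_lt_of_le ?_ (hρ.le.trans (iInf₂_le a haA))
    rw [edist_nndist]
    exact_mod_cast hxa
  obtain ⟨r, hr, hxr⟩ := lt_sSup_iff.1 h1
  exact hr x hxr

theorem isClosed_of_tube_subset_unp {d : ℕ} {A : Set (Euc d)} {ρ : ℝ} (hρ : 0 < ρ)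
    (h : ∀ x, infDist x A < ρ → x ∈ unp A) : IsClosed A := by
  refine isClosed_of_closure_subset fun x hx => ?_
  have h0 := infDist_zero_of_mem_closure hx
  obtain ⟨a, ⟨haA, hxa⟩, -⟩ := h x (by rwa [h0])
  rw [h0, dist_eq_zero] at hxa
  rwa [hxa]

/-- At a point with a unique nearest point the distance function has slope one. -/
theorem exists_infDist_ge_of_mem_unp {d : ℕ} {A : Set (Euc d)} (hAc : IsClosed A)
    {y : Euc d} (hy : y ∈ unp A) (hpos : 0 < infDist y A) {θ : ℝ} (hθ0 : 0 < θ) (hθ : θ < 1)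
    {δ : ℝ} (hδ : 0 < δ) :
    ∃ z, dist z y < δ ∧ infDist y A < infDist z A ∧
      infDist y A + θ * dist z y ≤ infDist z A := by
  obtain ⟨q, ⟨hqA, hyq⟩, huniq⟩ := hy
  have hne : A.Nonempty := ⟨q, hqA⟩
  set D := infDist y A with hD
  have hnorm : ‖y - q‖ = D := by rw [← hyq, dist_eq_norm]
  set v : Euc d := D⁻¹ • (y - q) with hv
  have hvn : ‖v‖ = 1 := by
    rw [hv, norm_smul, hnorm, norm_inv, Real.norm_of_nonneg hpos.le, inv_mul_cancel₀ hpos.ne']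
  have hvq : inner ℝ v (y - q) = D := by
    rw [hv, real_inner_smul_left, real_inner_self_eq_norm_sq, hnorm]
    field_simp
  let ε : ℕ → ℝ := fun n => 1 / ((n : ℝ) + 1)
  have hε0 : ∀ n, 0 < ε n := fun n => by positivity
  have hε : Tendsto ε atTop (𝓝 0) := tendsto_one_div_add_atTop_nhds_zero_nat
  choose a haA ha using fun n => hAc.exists_infDist_eq_dist hne (y + ε n • v)
  have hyn : Tendsto (fun n => y + ε n • v) atTop (𝓝 y) := by
    simpa using tendsto_const_nhds.add (hε.smul_const v)
  have hdn : Tendsto (fun n => dist (y + ε n • v) (a n)) atTop (𝓝 D) := by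
    simp_rw [← ha]
    exact ((continuous_infDist_pt A).tendsto y).comp hyn
  have hbdd : Bornology.IsBounded (range a) := by
    have h1 := isBounded_range_of_tendsto _ hyn
    have h2 := isBounded_range_of_tendsto _ hdn
    obtain ⟨C, hC⟩ := h2.exists_norm_le
    obtain ⟨C', hC'⟩ := h1.exists_norm_le
    refine isBounded_iff_forall_norm_le.2 ⟨C' + C, ?_⟩
    rintro _ ⟨n, rfl⟩
    have e1 := hC _ ⟨n, rfl⟩
    have e2 := hC' _ ⟨n, rfl⟩
    simp only [dist_eq_norm, norm_norm] at e1 e2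
    have := norm_sub_le (y + ε n • v) (y + ε n • v - a n)
    rw [sub_sub_cancel] at this
    linarith
  obtain ⟨b, -, φ, hφ, hb⟩ := tendsto_subseq_of_bounded hbdd (fun n => mem_range_self n)
  have hbA : b ∈ A := hAc.mem_of_tendsto hb (Eventually.of_forall fun n => haA _)
  have hyb : dist y b = D :=
    tendsto_nhds_unique ((hyn.comp hφ.tendsto_atTop).dist hb) (hdn.comp hφ.tendsto_atTop)
  obtain rfl : b = q := huniq b ⟨hbA, hyb⟩
  have hin : Tendsto (fun n => inner ℝ v (y - a (φ n))) atTop (𝓝 D) := by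
    rw [← hvq]
    exact tendsto_const_nhds.inner (tendsto_const_nhds.sub hb)
  have h1 : ∀ᶠ n in atTop, θ * D < inner ℝ v (y - a (φ n)) :=
    hin.eventually_const_lt (by nlinarith)
  have h2 : ∀ᶠ n in atTop, ε (φ n) < δ :=
    (hε.comp hφ.tendsto_atTop).eventually_lt_const hδ
  obtain ⟨n, hn1, hn2⟩ := (h1.and h2).exists
  have he := hε0 (φ n)
  set e := ε (φ n)
  have hdist : dist (y + e • v) y = e := by
    simp [dist_eq_norm, norm_smul, hvn, abs_of_pos he]
  have key : D + θ * e ≤ infDist (y + e • v) A := by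
    rw [ha, dist_eq_norm]
    refine le_of_sq_le_sq ?_ (norm_nonneg _)
    have hx : y + e • v - a (φ n) = (y - a (φ n)) + e • v := by abel
    rw [hx, norm_add_sq_real, norm_smul, hvn, real_inner_smul_right, real_inner_comm,
      Real.norm_of_nonneg he.le]
    have hDa : D ≤ ‖y - a (φ n)‖ := by
      rw [← dist_eq_norm]; exact infDist_le_dist_of_mem (haA _)
    have : D ^ 2 ≤ ‖y - a (φ n)‖ ^ 2 := by gcongr
    have h3 : e * (θ * D) ≤ e * inner ℝ v (y - a (φ n)) := by gcongr
    have h4 : θ ^ 2 * e ^ 2 ≤ e ^ 2 := by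
      have : θ ^ 2 ≤ 1 := by nlinarith
      nlinarith [sq_nonneg e]
    nlinarith
  refine ⟨y + e • v, by rwa [hdist], ?_, by rwa [hdist]⟩
  nlinarith [mul_pos hθ0 he]

/-- Nearly optimal ascent of the distance function inside the tube of unique nearest points. -/
theorem exists_infDist_ascent {d : ℕ} {A : Set (Euc d)} {ρ : ℝ} (hAc : IsClosed A)
    (h : ∀ x, infDist x A < ρ → x ∈ unp A) {x : Euc d} (hx : 0 < infDist x A) {s : ℝ}
    (hs0 : 0 ≤ s) (hs : infDist x A + s < ρ) {θ : ℝ} (hθ0 : 0 < θ) (hθ : θ < 1) :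
    ∃ y, dist y x = s ∧ infDist x A + θ * s ≤ infDist y A := by
  let K : Set (Euc d) := closedBall x s ∩ {y | infDist x A + θ * dist y x ≤ infDist y A}
  have hK : IsCompact K := (isCompact_closedBall x s).inter_right
    (isClosed_le (by fun_prop) (continuous_infDist_pt A))
  obtain ⟨y, ⟨hyx, hy⟩, hmax⟩ := hK.exists_isMaxOn ⟨x, by simp [hs0], by simp⟩
    (continuous_infDist_pt A).continuousOn
  rw [mem_closedBall] at hyx
  rw [mem_ofPred_eq] at hy
  rcases hyx.eq_or_lt with hyx' | hyx'
  · exact ⟨y, hyx', by rwa [hyx'] at hy⟩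
  exfalso
  have hub : infDist y A ≤ infDist x A + dist y x := infDist_le_infDist_add_dist
  have hpos : 0 < infDist y A := by nlinarith [dist_nonneg (x := y) (y := x)]
  obtain ⟨z, hz1, hz2, hz3⟩ := exists_infDist_ge_of_mem_unp hAc (h y (by linarith)) hpos hθ0 hθ
    (sub_pos.2 hyx')
  have htri := dist_triangle z y x
  have hzK : z ∈ K := by
    refine ⟨by rw [mem_closedBall]; linarith, ?_⟩
    rw [mem_ofPred_eq]
    nlinarith
  exact absurd (hmax hzK) (not_le.2 hz2)

/-- Inside the tube, a nearest point stays nearest when moving outward along the normal, which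
gives the supporting ball inequality. -/
theorem inner_le_of_nearest {d : ℕ} {A : Set (Euc d)} {ρ : ℝ} (hAc : IsClosed A)
    (h : ∀ x, infDist x A < ρ → x ∈ unp A) {t : ℝ} (ht : t < ρ)
    {x q c : Euc d} (hq : q ∈ A) (hc : c ∈ A) (hxq : dist x q = infDist x A)
    (hxt : infDist x A ≤ t) :
    2 * t * inner ℝ (c - q) (x - q) ≤ infDist x A * ‖c - q‖ ^ 2 := by
  rcases infDist_nonneg.eq_or_lt (a := (0 : ℝ)) (b := infDist x A) with h0 | hpos
  · rw [← h0, dist_eq_zero] at hxq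
    simp [hxq, infDist_zero_of_mem hq]
  set D := infDist x A with hD
  have hlim : Tendsto (fun n : ℕ => 1 - 1 / ((n : ℝ) + 2)) atTop (𝓝 1) := by
    have := (tendsto_one_div_add_atTop_nhds_zero_nat (𝕜 := ℝ)).comp (tendsto_add_atTop_nat 1)
    have h2 := this.const_sub 1
    rw [sub_zero] at h2
    refine h2.congr fun n => ?_
    simp only [Function.comp]
    push_cast
    ring
  have hθ : ∀ n : ℕ, 0 < 1 - 1 / ((n : ℝ) + 2) ∧ 1 - 1 / ((n : ℝ) + 2) < 1 := fun n => by
    have : 1 / ((n : ℝ) + 2) < 1 := by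
      rw [div_lt_one (by positivity)]; linarith [n.cast_nonneg (α := ℝ)]
    have : 0 < 1 / ((n : ℝ) + 2) := by positivity
    constructor <;> linarith
  choose y hyx hy using fun n : ℕ => exists_infDist_ascent hAc h hpos (sub_nonneg.2 hxt)
    (by linarith) (hθ n).1 (hθ n).2
  obtain ⟨z, hz, φ, hφ, hyz⟩ := (isCompact_sphere x (t - D)).tendsto_subseq
    (x := y) (fun n => hyx n)
  have hzD : D + 1 * (t - D) ≤ infDist z A :=
    le_of_tendsto_of_tendsto
      (((hlim.comp hφ.tendsto_atTop).mul_const (t - D)).const_add D)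
      (((continuous_infDist_pt A).tendsto z).comp hyz)
      (Eventually.of_forall fun n => hy (φ n))
  have hzx : ‖z - x‖ = t - D := by rw [← dist_eq_norm]; exact hz
  have hxqn : ‖x - q‖ = D := by rw [← dist_eq_norm]; exact hxq
  have hzq : t ≤ ‖z - q‖ := by
    rw [← dist_eq_norm]; linarith [infDist_le_dist_of_mem (x := z) hq]
  have hzc : t ≤ ‖z - c‖ := by
    rw [← dist_eq_norm]; linarith [infDist_le_dist_of_mem (x := z) hc]
  have hsum : z - q = (z - x) + (x - q) := by abel
  have hadd : ‖(z - x) + (x - q)‖ = ‖z - x‖ + ‖x - q‖ := by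
    refine le_antisymm (norm_add_le _ _) ?_
    rw [← hsum]; linarith
  have hsame := (sameRay_iff_norm_add.2 hadd).norm_smul_eq
  rw [hzx, hxqn] at hsame
  have hDz : D • (z - q) = t • (x - q) := by
    rw [hsum, smul_add, ← hsame, ← add_smul]; congr 1; ring
  have hzqn : ‖z - q‖ = t := by rw [hsum, hadd]; linarith
  have hexp : ‖z - c‖ ^ 2 = ‖z - q‖ ^ 2 - 2 * inner ℝ (z - q) (c - q) + ‖c - q‖ ^ 2 := by
    rw [← norm_sub_sq_real]; congr 2; abel
  have h3 : 2 * inner ℝ (z - q) (c - q) ≤ ‖c - q‖ ^ 2 := by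
    have : t ^ 2 ≤ ‖z - c‖ ^ 2 := pow_le_pow_left₀ (hpos.le.trans hxt) hzc 2
    rw [hexp, hzqn] at this; linarith
  have h4 : D * inner ℝ (z - q) (c - q) = t * inner ℝ (c - q) (x - q) := by
    rw [← real_inner_smul_left, hDz, real_inner_smul_left, real_inner_comm]
  nlinarith

/-- Chords of a set of positive reach stay quadratically close to the set. -/
theorem infDist_chord_le {d : ℕ} {A : Set (Euc d)} {ρ : ℝ} (hAc : IsClosed A)
    (h : ∀ x, infDist x A < ρ → x ∈ unp A) {t : ℝ} (ht0 : 0 < t) (ht : t < ρ)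
    {a b : Euc d} (ha : a ∈ A) (hb : b ∈ A) (hab : ‖b - a‖ ≤ t) {s : ℝ} (hs0 : 0 ≤ s)
    (hs1 : s ≤ 1) : infDist (a + s • (b - a)) A ≤ s * (‖b - a‖ ^ 2 / t) := by
  set p := a + s • (b - a) with hp
  obtain ⟨q, hqA, hq⟩ := hAc.exists_infDist_eq_dist ⟨a, ha⟩ p
  have hD0 : 0 ≤ infDist p A := infDist_nonneg
  have hDs : infDist p A ≤ t := by
    refine (infDist_le_dist_of_mem ha).trans ?_
    rw [dist_eq_norm, hp, add_sub_cancel_left, norm_smul, Real.norm_of_nonneg hs0]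
    nlinarith [norm_nonneg (b - a)]
  have h1 := inner_le_of_nearest hAc h ht hqA ha hq.symm hDs
  have h2 := inner_le_of_nearest hAc h ht hqA hb hq.symm hDs
  have hn : ‖p - q‖ = infDist p A := by rw [hq, dist_eq_norm]
  set D := infDist p A
  have hpq : p - q = (1 - s) • (a - q) + s • (b - q) := by rw [hp]; module
  have e1 : D ^ 2 = (1 - s) * inner ℝ (a - q) (p - q) + s * inner ℝ (b - q) (p - q) := by
    rw [← hn, ← real_inner_self_eq_norm_sq, ← real_inner_smul_left, ← real_inner_smul_left,
      ← inner_add_left, ← hpq]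
  have e2 : (1 - s) * ‖a - q‖ ^ 2 + s * ‖b - q‖ ^ 2 = D ^ 2 + s * (1 - s) * ‖b - a‖ ^ 2 := by
    have hba : b - a = (b - q) - (a - q) := by abel
    rw [← hn, hpq, hba, norm_sub_sq_real (b - q), norm_add_sq_real, norm_smul, norm_smul,
      real_inner_smul_left, real_inner_smul_right, real_inner_comm (a - q) (b - q),
      Real.norm_of_nonneg hs0, Real.norm_of_nonneg (sub_nonneg.2 hs1)]
    ring
  have e3 : 2 * t * D ^ 2 ≤ D * (D ^ 2 + s * (1 - s) * ‖b - a‖ ^ 2) := by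
    rw [← e2, e1]
    nlinarith [mul_le_mul_of_nonneg_left h1 (sub_nonneg.2 hs1), mul_le_mul_of_nonneg_left h2 hs0]
  rcases hD0.eq_or_lt with h0 | hpos
  · rw [← h0]; positivity
  have e4 : 2 * t * D ≤ D ^ 2 + s * (1 - s) * ‖b - a‖ ^ 2 := by
    refine le_of_mul_le_mul_left ?_ hpos
    linarith
  rw [← mul_div_assoc, le_div_iff₀ ht0]
  have e5 : s * (1 - s) * ‖b - a‖ ^ 2 ≤ s * ‖b - a‖ ^ 2 := by
    gcongr; nlinarith
  nlinarith

/-- Federer's estimate: displacements inside the set are quadratically close to tangent vectors. -/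
theorem exists_mem_tanCone_near_sub {d : ℕ} {A : Set (Euc d)} {ρ : ℝ} (hAc : IsClosed A)
    (h : ∀ x, infDist x A < ρ → x ∈ unp A) {t : ℝ} (ht0 : 0 < t) (ht : t < ρ)
    {a b : Euc d} (ha : a ∈ A) (hb : b ∈ A) (hab : ‖b - a‖ ≤ t) :
    ∃ w ∈ tanCone A a, ‖w - (b - a)‖ ≤ ‖b - a‖ ^ 2 / t := by
  let s : ℕ → ℝ := fun n => 1 / ((n : ℝ) + 1)
  have hs0 : ∀ n, 0 < s n := fun n => by positivity
  have hs1 : ∀ n, s n ≤ 1 := fun n => by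
    simp only [s]
    rw [div_le_one (by positivity)]; linarith [n.cast_nonneg (α := ℝ)]
  have hs : Tendsto s atTop (𝓝 0) := tendsto_one_div_add_atTop_nhds_zero_nat
  choose q hqA hq using fun n => hAc.exists_infDist_eq_dist ⟨a, ha⟩ (a + s n • (b - a))
  have hw : ∀ n, (s n)⁻¹ • (q n - a) ∈ closedBall (b - a) (‖b - a‖ ^ 2 / t) := fun n => by
    have h1 := infDist_chord_le hAc h ht0 ht ha hb hab (hs0 n).le (hs1 n)
    rw [hq, dist_eq_norm, norm_sub_rev] at h1
    rw [mem_closedBall, dist_eq_norm]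
    have : (s n)⁻¹ • (q n - a) - (b - a) = (s n)⁻¹ • (q n - (a + s n • (b - a))) := by
      rw [← sub_sub, smul_sub _ (q n - a), inv_smul_smul₀ (hs0 n).ne']
    rw [this, norm_smul, norm_inv, Real.norm_of_nonneg (hs0 n).le, inv_mul_le_iff₀ (hs0 n)]
    exact h1
  obtain ⟨w, hwm, φ, hφ, hlim⟩ := (isCompact_closedBall _ _).tendsto_subseq hw
  refine ⟨w, mem_tanCone_of_tendsto (x := q ∘ φ) (r := fun n => (s (φ n))⁻¹) (fun n => hqA _) ?_
    (fun n => inv_pos.2 (hs0 _)) hlim, by rwa [mem_closedBall, dist_eq_norm] at hwm⟩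
  have h2 := ((hs.comp hφ.tendsto_atTop).smul hlim).add_const a
  rw [zero_smul, zero_add] at h2
  refine h2.congr fun n => ?_
  simp [smul_inv_smul₀ (hs0 (φ n)).ne']

/-- Lower semicontinuity of the tangent cone. -/
theorem eventually_exists_mem_tanCone_dist_lt {d : ℕ} {A : Set (Euc d)} {ρ : ℝ} (hρ : 0 < ρ)
    (h : ∀ x, infDist x A < ρ → x ∈ unp A) {x u : Euc d}
    (hu : u ∈ tanCone A x) {ε : ℝ} (hε : 0 < ε) :
    ∀ᶠ a in 𝓝[A] x, ∃ w ∈ tanCone A a, dist w u < ε := by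
  have hAc := isClosed_of_tube_subset_unp hρ h
  rcases hu with rfl | ⟨y, r, hyA, hy, hr, hu⟩
  · exact Eventually.of_forall fun a => ⟨0, Or.inl rfl, by simpa using hε⟩
  obtain ⟨t, ht0, ht⟩ := exists_between hρ
  have hy0 : Tendsto (fun n => ‖y n - x‖) atTop (𝓝 0) := by
    simpa using (hy.sub_const x).norm
  have herr : Tendsto (fun n => r n * (‖y n - x‖ ^ 2 / t) + ‖r n • (y n - x) - u‖) atTop
      (𝓝 0) := by
    have h1 := ((hu.norm.mul hy0).div_const t).add (hu.sub_const u).norm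
    simp only [mul_zero, zero_div, sub_self, norm_zero, add_zero] at h1
    refine h1.congr fun n => ?_
    rw [norm_smul, Real.norm_of_nonneg (hr n).le]
    ring
  obtain ⟨n, hn1, hn2⟩ :=
    ((hy0.eventually_lt_const ht0).and (herr.eventually_lt_const hε)).exists
  have hc1 : ∀ᶠ a in 𝓝[A] x, ‖y n - a‖ < t := by
    refine nhdsWithin_le_nhds (Tendsto.eventually_lt_const hn1 (Continuous.tendsto ?_ x))
    fun_prop
  have hc2 : ∀ᶠ a in 𝓝[A] x, r n * (‖y n - a‖ ^ 2 / t) + ‖r n • (y n - a) - u‖ < ε := by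
    refine nhdsWithin_le_nhds (Tendsto.eventually_lt_const hn2 (Continuous.tendsto ?_ x))
    fun_prop
  filter_upwards [hc1, hc2, self_mem_nhdsWithin] with a ha1 ha2 haA
  obtain ⟨w, hw, hwd⟩ := exists_mem_tanCone_near_sub hAc h ht0 ht haA (hyA n).1 ha1.le
  refine ⟨r n • w, smul_mem_tanCone hw (hr n), ?_⟩
  have h1 : r n • w - u = r n • (w - (y n - a)) + (r n • (y n - a) - u) := by module
  rw [dist_eq_norm, h1]
  refine (norm_add_le _ _).trans_lt (lt_of_le_of_lt ?_ ha2)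
  rw [norm_smul, Real.norm_of_nonneg (hr n).le]
  gcongr
  exact (hr n).le

/-- Lower semicontinuity of the dimension of the tangent cone. -/
theorem eventually_tanDim_le {d : ℕ} {A : Set (Euc d)} {ρ : ℝ} (hρ : 0 < ρ)
    (h : ∀ x, infDist x A < ρ → x ∈ unp A) (x : Euc d) :
    ∀ᶠ a in 𝓝[A] x, tanDim A x ≤ tanDim A a := by
  obtain ⟨u, hu, -, hli⟩ := Submodule.exists_fun_fin_finrank_span_eq ℝ (tanCone A x)
  obtain ⟨ε, hε, hball⟩ := Metric.isOpen_iff.1 isOpen_setOfPred_linearIndependent u hli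
  filter_upwards [eventually_all.2 fun i =>
    eventually_exists_mem_tanCone_dist_lt hρ h (hu i) hε] with a ha
  choose w hw hwu using ha
  have hwli : LinearIndependent ℝ w := hball ((dist_pi_lt_iff hε).2 hwu)
  have hmono := Submodule.finrank_mono (Submodule.span_mono (R := ℝ) (range_subset_iff.2 hw))
  rwa [finrank_span_eq_card hwli, Fintype.card_fin] at hmono

theorem exists_ball_inter_subset_of_tanDim_eq_zero {d : ℕ} {A : Set (Euc d)} {ρ : ℝ}
    (hρ : 0 < ρ) (h : ∀ x, infDist x A < ρ → x ∈ unp A) {x : Euc d} (hx : x ∈ A)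
    (h0 : tanDim A x = 0) : ∃ t > 0, ∀ b ∈ A, dist b x < t → b = x := by
  obtain ⟨t, ht0, ht⟩ := exists_between hρ
  refine ⟨t, ht0, fun b hb hbx => ?_⟩
  rw [dist_eq_norm] at hbx
  obtain ⟨w, hw, hwd⟩ := exists_mem_tanCone_near_sub (isClosed_of_tube_subset_unp hρ h) h ht0 ht
    hx hb hbx.le
  have hw0 : w = 0 := by
    have := Submodule.subset_span (R := ℝ) hw
    rwa [Submodule.finrank_eq_zero.1 h0] at this
  rw [hw0, zero_sub, norm_neg, le_div_iff₀ ht0] at hwd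
  by_contra hne
  have hpos : 0 < ‖b - x‖ := norm_pos_iff.2 (sub_ne_zero.2 hne)
  nlinarith

theorem stmt11 {d k : ℕ} (A : Set (Euc d)) (hA : 0 < reach A) (hk : 1 ≤ k) (hkd : k ≤ d) :
    Tk A k ∩ closure (⋃ i ∈ Finset.range k, Tk A i) = ∅ ∧ IsClosed (Tk A 1) := by
  rcases A.eq_empty_or_nonempty with rfl | hne
  · simp [Tk]
  obtain ⟨ρ, hρ, h⟩ := exists_tube_subset_unp hA hne
  have hAc := isClosed_of_tube_subset_unp hρ h
  constructor
  · refine eq_empty_of_forall_notMem fun x ⟨⟨hxA, hxk⟩, hxc⟩ => ?_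
    obtain ⟨a, ha, ha'⟩ := ((mem_closure_iff_frequently.1 hxc).and_eventually
      (eventually_nhdsWithin_iff.1 (eventually_tanDim_le hρ h x))).exists
    simp only [mem_iUnion, Finset.mem_range] at ha
    obtain ⟨i, hi, haA, hai⟩ := ha
    have := ha' haA
    omega
  · refine isClosed_of_closure_subset fun x hx => ?_
    have hxA : x ∈ A := hAc.closure_subset_iff.2 (fun y hy => hy.1) hx
    obtain ⟨a, ⟨haA, ha1⟩, ha'⟩ := ((mem_closure_iff_frequently.1 hx).and_eventually
      (eventually_nhdsWithin_iff.1 (eventually_tanDim_le hρ h x))).exists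
    have hle := ha' haA
    rw [ha1] at hle
    rcases Nat.le_one_iff_eq_zero_or_eq_one.1 hle with h0 | h1
    · obtain ⟨t, ht, hiso⟩ := exists_ball_inter_subset_of_tanDim_eq_zero hρ h hxA h0
      obtain ⟨b, hb, hbx⟩ := Metric.mem_closure_iff.1 hx t ht
      rw [dist_comm] at hbx
      rwa [← hiso b hb.1 hbx]
    · exact ⟨hxA, h1⟩
end
end

section
/- Let A ⊆ ℝ^d have positive reach and 1 ≤ k ≤ d. Then the map ψ_k : T_k(A) → G(d,k), ψ_k(x) = span(Tan(A,x)), is continuous with respect to the metric ρ_k on the Grassmannian. -/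
open Metric Set MeasureTheory
open scoped RealInnerProductSpace ENNReal NNReal

noncomputable section

/-- If every point within distance `R` of `A` has a nearest point in `A`, then `A` is closed. -/
theorem isClosed_of_unp {d : ℕ} {A : Set (Euc d)} {R : ℝ} (hR : 0 < R)
    (H : ∀ x, infDist x A ≤ R → x ∈ unp A) : IsClosed A := by
  refine isClosed_of_closure_subset fun x hx => ?_
  have h0 : infDist x A = 0 := infDist_zero_of_mem_closure hx
  obtain ⟨a, ⟨haA, ha⟩, -⟩ := H x (by rw [h0]; exact hR.le)
  rw [h0, dist_eq_zero] at ha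
  rwa [ha]

theorem exists_pos_unp_of_reach_pos {d : ℕ} {A : Set (Euc d)} (hA : 0 < reach A)
    (hne : A.Nonempty) : ∃ R > (0 : ℝ), ∀ x, infDist x A ≤ R → x ∈ unp A := by
  obtain ⟨r, hr0, hr⟩ := ENNReal.lt_iff_exists_nnreal_btwn.1 hA
  have hr0' : (0 : ℝ) < r := by exact_mod_cast hr0
  refine ⟨r / 2, by positivity, fun x hx => ?_⟩
  obtain ⟨a, haA, ha⟩ := (infDist_lt_iff hne).1 (show infDist x A < r by linarith)
  have h1 : (r : ℝ≥0∞) < reachAt A a := hr.trans_le (iInf₂_le a haA)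
  obtain ⟨s, hs, hrs⟩ := lt_sSup_iff.1 h1
  refine hs x (lt_trans ?_ hrs)
  rw [edist_nndist]
  exact_mod_cast ha

/-- Nearest points of points close to `z` are close to the unique nearest point of `z`. -/
theorem exists_nearest_close {d : ℕ} {A : Set (Euc d)} (hcl : IsClosed A) {z a : Euc d}
    (huniq : ∀ b ∈ A, dist z b = infDist z A → b = a) {ε : ℝ} (hε : 0 < ε) :
    ∃ g > (0 : ℝ), ∀ w b, dist w z < g → b ∈ A → dist w b = infDist w A → dist b a < ε := by
  set K : Set (Euc d) := A ∩ {b | ε ≤ dist b a} with hK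
  have hKcl : IsClosed K := hcl.inter (isClosed_le continuous_const (by fun_prop))
  rcases K.eq_empty_or_nonempty with hE | hne
  · refine ⟨1, one_pos, fun w b _ hb _ => ?_⟩
    by_contra! h
    have : b ∈ K := ⟨hb, h⟩
    simp [hE] at this
  · obtain ⟨c, hcK, hc⟩ := hKcl.exists_infDist_eq_dist hne z
    have hlt : infDist z A < infDist z K := by
      refine lt_of_le_of_ne (infDist_le_infDist_of_subset inter_subset_left hne) fun h => ?_
      have hca : c = a := huniq c hcK.1 (by rw [← hc, h])
      have h2 : ε ≤ dist c a := hcK.2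
      rw [hca, dist_self] at h2
      linarith
    refine ⟨(infDist z K - infDist z A) / 2, by linarith, fun w b hw hb hwb => ?_⟩
    by_contra! h
    have h1 : infDist z K ≤ dist z b := infDist_le_dist_of_mem ⟨hb, h⟩
    have h2 : infDist w A ≤ infDist z A + dist w z := infDist_le_infDist_add_dist
    have h3 : dist z b ≤ dist z w + dist w b := dist_triangle _ _ _
    rw [dist_comm z w] at h3
    linarith

/-- Moving away from the unique nearest point increases the distance at rate almost one. -/
theorem exists_step {d : ℕ} {A : Set (Euc d)} (hcl : IsClosed A) {z a : Euc d} (haA : a ∈ A)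
    (ha : dist z a = infDist z A) (huniq : ∀ b ∈ A, dist z b = infDist z A → b = a)
    (hpos : 0 < infDist z A) {c : ℝ} (hc1 : c < 1) {η : ℝ} (hη : 0 < η) :
    ∃ w, 0 < dist w z ∧ dist w z < η ∧ infDist z A + c * dist w z < infDist w A := by
  set s := infDist z A with hs
  set n : Euc d := s⁻¹ • (z - a) with hn
  have hza : ‖z - a‖ = s := by rw [← dist_eq_norm, ha]
  have hn1 : ‖n‖ = 1 := by
    rw [hn, norm_smul, hza, norm_inv, Real.norm_of_nonneg hpos.le, inv_mul_cancel₀ hpos.ne']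
  have hcont : ContinuousAt (fun b : Euc d => ⟪n, z - b⟫ - c * ‖z - b‖) a := by fun_prop
  have hval : 0 < ⟪n, z - a⟫ - c * ‖z - a‖ := by
    rw [hn, real_inner_smul_left, real_inner_self_eq_norm_sq, hza]
    have : s⁻¹ * s ^ 2 = s := by field_simp
    rw [this]
    nlinarith
  obtain ⟨ε, hε, hball⟩ := Metric.eventually_nhds_iff.1 (hcont.eventually (lt_mem_nhds hval))
  obtain ⟨g, hg, hnear⟩ := exists_nearest_close hcl huniq hε
  set h := min g η / 2 with hh
  have hm : 0 < min g η := lt_min hg hη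
  have hh0 : 0 < h := by positivity
  have hdist : dist (z + h • n) z = h := by
    rw [dist_eq_norm, add_sub_cancel_left, norm_smul, hn1, mul_one, Real.norm_of_nonneg hh0.le]
  refine ⟨z + h • n, by rwa [hdist], ?_, ?_⟩
  · rw [hdist]; linarith [min_le_right g η]
  rw [hdist]
  obtain ⟨b, hbA, hb⟩ := hcl.exists_infDist_eq_dist ⟨a, haA⟩ (z + h • n)
  have h1 := hball (hnear _ b (by rw [hdist]; linarith [min_le_left g η]) hbA hb.symm)
  have h2 : s ≤ ‖z - b‖ := by
    rw [← dist_eq_norm]; exact infDist_le_dist_of_mem hbA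
  have h3 : ⟪z + h • n - b, z - b⟫ ≤ ‖z + h • n - b‖ * ‖z - b‖ := real_inner_le_norm _ _
  have h4 : ⟪z + h • n - b, z - b⟫ = ‖z - b‖ ^ 2 + h * ⟪n, z - b⟫ := by
    rw [show z + h • n - b = (z - b) + h • n by abel, inner_add_left, real_inner_smul_left,
      real_inner_self_eq_norm_sq]
  rw [hb, dist_eq_norm]
  have h5 : (‖z - b‖ + h * c) * ‖z - b‖ < ‖z + h • n - b‖ * ‖z - b‖ := by
    have := mul_pos hh0 h1
    nlinarith
  have h6 := lt_of_mul_lt_mul_right h5 (norm_nonneg _)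
  linarith

theorem exists_mem_sphere_le_infDist {d : ℕ} {A : Set (Euc d)} {R : ℝ} (hR : 0 < R)
    (H : ∀ x, infDist x A ≤ R → x ∈ unp A) {p : Euc d} (hp : 0 < infDist p A) {ρ : ℝ}
    (hρ : 0 < ρ) (hpρ : infDist p A + ρ ≤ R) {c : ℝ} (hc0 : 0 < c) (hc1 : c < 1) :
    ∃ z ∈ sphere p ρ, infDist p A + c * ρ ≤ infDist z A := by
  have hcont : Continuous fun z => infDist z A - c * dist z p := by
    have := continuous_infDist_pt A
    fun_prop
  obtain ⟨z, hz, hmax⟩ := (isCompact_closedBall p ρ).exists_isMaxOn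
    (nonempty_closedBall.2 hρ.le) hcont.continuousOn
  have hzp : dist z p ≤ ρ := hz
  have h0 : infDist p A - c * dist p p ≤ infDist z A - c * dist z p :=
    hmax (mem_closedBall_self hρ.le)
  rw [dist_self] at h0
  rcases hzp.eq_or_lt with heq | hlt
  · exact ⟨z, heq, by rw [heq] at h0; linarith⟩
  exfalso
  have hzpos : 0 < infDist z A := by
    have := mul_nonneg hc0.le (dist_nonneg (x := z) (y := p))
    linarith
  have hzR : infDist z A ≤ R := by
    have : infDist z A ≤ infDist p A + dist z p := infDist_le_infDist_add_dist
    linarith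
  obtain ⟨a, ⟨haA, ha⟩, huniq⟩ := H z hzR
  obtain ⟨w, hw0, hw1, hw2⟩ := exists_step (isClosed_of_unp hR H) haA ha
    (fun b hb hb' => huniq b ⟨hb, hb'⟩) hzpos hc1 (sub_pos.2 hlt)
  have htri : dist w p ≤ dist w z + dist z p := dist_triangle _ _ _
  have h1 : infDist w A - c * dist w p ≤ infDist z A - c * dist z p :=
    hmax (show dist w p ≤ ρ by linarith)
  have := mul_le_mul_of_nonneg_left htri hc0.le
  linarith

theorem exists_mem_sphere_add_le_infDist {d : ℕ} {A : Set (Euc d)} {R : ℝ} (hR : 0 < R)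
    (H : ∀ x, infDist x A ≤ R → x ∈ unp A) {p : Euc d} (hp : 0 < infDist p A) {ρ : ℝ}
    (hρ : 0 < ρ) (hpρ : infDist p A + ρ ≤ R) :
    ∃ z ∈ sphere p ρ, infDist p A + ρ ≤ infDist z A := by
  obtain ⟨z₀, hz₀, -⟩ := exists_mem_sphere_le_infDist hR H hp hρ hpρ
    (c := 1 / 2) (by norm_num) (by norm_num)
  obtain ⟨z, hz, hmax⟩ := (isCompact_sphere p ρ).exists_isMaxOn ⟨z₀, hz₀⟩
    (continuous_infDist_pt A).continuousOn
  refine ⟨z, hz, ?_⟩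
  by_contra! hlt
  set c := max (1 / 2) ((infDist z A - infDist p A + ρ) / (2 * ρ)) with hc
  have hc1 : c < 1 := by
    refine max_lt (by norm_num) ?_
    rw [div_lt_one (by positivity)]
    linarith
  obtain ⟨w, hw, hw'⟩ := exists_mem_sphere_le_infDist hR H hp hρ hpρ (c := c)
    (lt_of_lt_of_le (by norm_num) (le_max_left _ _)) hc1
  have h1 : infDist w A ≤ infDist z A := hmax hw
  have h2 := le_max_right (1 / 2) ((infDist z A - infDist p A + ρ) / (2 * ρ))
  rw [← hc, div_le_iff₀ (by positivity)] at h2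
  linarith

/-- Federer's inequality for the nearest point `q` of `p`. -/
theorem inner_le_of_nearest_s12 {d : ℕ} {A : Set (Euc d)} {R : ℝ} (hR : 0 < R)
    (H : ∀ x, infDist x A ≤ R → x ∈ unp A) {p q : Euc d} (hp : 0 < infDist p A)
    (hpR : infDist p A < R) (hqA : q ∈ A) (hq : dist p q = infDist p A) {a : Euc d}
    (ha : a ∈ A) : 2 * R * ⟪p - q, a - q⟫ ≤ infDist p A * ‖a - q‖ ^ 2 := by
  obtain ⟨z, hz, hzA⟩ := exists_mem_sphere_add_le_infDist hR H hp (sub_pos.2 hpR) (by linarith)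
  set s := infDist p A with hs
  have hpq : ‖p - q‖ = s := by rw [← dist_eq_norm, hq]
  have hzp : ‖z - p‖ = R - s := by rw [← dist_eq_norm]; exact hz
  have hzq : R ≤ ‖z - q‖ := by
    rw [← dist_eq_norm]
    linarith [infDist_le_dist_of_mem (x := z) hqA]
  have hza : R ≤ ‖z - a‖ := by
    rw [← dist_eq_norm]
    linarith [infDist_le_dist_of_mem (x := z) ha]
  have e1 : ‖z - q‖ ^ 2 = ‖z - p‖ ^ 2 + 2 * ⟪z - p, p - q⟫ + ‖p - q‖ ^ 2 := by
    rw [← norm_add_sq_real, sub_add_sub_cancel]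
  have hin : s * (R - s) ≤ ⟪z - p, p - q⟫ := by
    rw [hzp, hpq] at e1
    nlinarith
  have hcol : s • (z - p) - (R - s) • (p - q) = 0 := by
    rw [← norm_eq_zero, ← sq_eq_zero_iff]
    refine le_antisymm ?_ (sq_nonneg _)
    rw [norm_sub_sq_real, norm_smul, norm_smul, real_inner_smul_left, real_inner_smul_right,
      hzp, hpq, Real.norm_of_nonneg hp.le, Real.norm_of_nonneg (sub_pos.2 hpR).le]
    have := mul_le_mul_of_nonneg_left hin (mul_pos hp (sub_pos.2 hpR)).le
    nlinarith
  have hzq' : s • (z - q) = R • (p - q) := by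
    have : s • (z - q) - R • (p - q) = s • (z - p) - (R - s) • (p - q) := by module
    rw [← sub_eq_zero, this, hcol]
  have hnzq : ‖z - q‖ = R := by
    have := congrArg norm hzq'
    rw [norm_smul, norm_smul, hpq, Real.norm_of_nonneg hp.le, Real.norm_of_nonneg hR.le] at this
    exact mul_left_cancel₀ hp.ne' (by linarith)
  have e2 : ‖z - a‖ ^ 2 = ‖z - q‖ ^ 2 - 2 * ⟪z - q, a - q⟫ + ‖a - q‖ ^ 2 := by
    rw [← norm_sub_sq_real, sub_sub_sub_cancel_right]
  have e3 : s * ⟪z - q, a - q⟫ = R * ⟪p - q, a - q⟫ := by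
    rw [← real_inner_smul_left, hzq', real_inner_smul_left]
  have h4 : 2 * ⟪z - q, a - q⟫ ≤ ‖a - q‖ ^ 2 := by
    rw [hnzq] at e2
    nlinarith
  have := mul_le_mul_of_nonneg_left h4 hp.le
  linarith

/-- Points of a chord of `A` are quadratically close to `A`. -/
theorem exists_near_chord {d : ℕ} {A : Set (Euc d)} {R : ℝ} (hR : 0 < R)
    (H : ∀ x, infDist x A ≤ R → x ∈ unp A) {a b : Euc d} (ha : a ∈ A) (hb : b ∈ A)
    {t : ℝ} (ht0 : 0 ≤ t) (ht1 : t ≤ 1) (htR : t * ‖b - a‖ < R) :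
    ∃ q ∈ A, ‖a + t • (b - a) - q‖ ≤ t * ‖b - a‖ ^ 2 / R := by
  set p := a + t • (b - a) with hp
  have hpa : dist p a = t * ‖b - a‖ := by
    rw [dist_eq_norm, hp, add_sub_cancel_left, norm_smul, Real.norm_of_nonneg ht0]
  have hsR : infDist p A < R := (infDist_le_dist_of_mem ha).trans_lt (by rwa [hpa])
  obtain ⟨q, ⟨hqA, hq⟩, -⟩ := H p hsR.le
  refine ⟨q, hqA, ?_⟩
  rw [← dist_eq_norm, hq]
  rcases (infDist_nonneg (x := p) (s := A)).eq_or_lt with h0 | hpos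
  · rw [← h0]; positivity
  have h1 := inner_le_of_nearest_s12 hR H hpos hsR hqA hq ha
  have h2 := inner_le_of_nearest_s12 hR H hpos hsR hqA hq hb
  set s := infDist p A with hs
  have hpq : ‖p - q‖ = s := by rw [← dist_eq_norm, hq]
  have hcomb : p - q = (1 - t) • (a - q) + t • (b - q) := by rw [hp]; module
  have e1 : (1 - t) * ⟪p - q, a - q⟫ + t * ⟪p - q, b - q⟫ = s ^ 2 := by
    rw [← hpq, ← real_inner_self_eq_norm_sq, ← real_inner_smul_right, ← real_inner_smul_right,
      ← inner_add_right, ← hcomb]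
  have e2 : (1 - t) * ‖a - q‖ ^ 2 + t * ‖b - q‖ ^ 2 = s ^ 2 + t * (1 - t) * ‖b - a‖ ^ 2 := by
    have e3 : s ^ 2 = (1 - t) ^ 2 * ‖a - q‖ ^ 2 + 2 * ((1 - t) * t * ⟪a - q, b - q⟫)
        + t ^ 2 * ‖b - q‖ ^ 2 := by
      rw [← hpq, hcomb, norm_add_sq_real, norm_smul, norm_smul, real_inner_smul_left,
        real_inner_smul_right, mul_pow, mul_pow, Real.norm_eq_abs, Real.norm_eq_abs, sq_abs,
        sq_abs]
      ring
    have e4 : ‖b - a‖ ^ 2 = ‖b - q‖ ^ 2 - 2 * ⟪a - q, b - q⟫ + ‖a - q‖ ^ 2 := by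
      rw [real_inner_comm, ← norm_sub_sq_real, sub_sub_sub_cancel_right]
    rw [e3, e4]
    ring
  have h3 : s * (2 * R * s) ≤ s * (s ^ 2 + t * (1 - t) * ‖b - a‖ ^ 2) := by
    rw [← e2]
    have h1' := mul_le_mul_of_nonneg_left h1 (sub_nonneg.2 ht1)
    have h2' := mul_le_mul_of_nonneg_left h2 ht0
    calc s * (2 * R * s) = 2 * R * s ^ 2 := by ring
      _ = (1 - t) * (2 * R * ⟪p - q, a - q⟫) + t * (2 * R * ⟪p - q, b - q⟫) := by
        rw [← e1]; ring
      _ ≤ _ := by linarith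
  have h4 := le_of_mul_le_mul_left h3 hpos
  rw [le_div_iff₀ hR]
  have h5 : 0 ≤ t ^ 2 * ‖b - a‖ ^ 2 := by positivity
  nlinarith

theorem smul_mem_tanCone_s12 {d : ℕ} {A : Set (Euc d)} {a v : Euc d} (hv : v ∈ tanCone A a) {r : ℝ}
    (hr : 0 < r) : r • v ∈ tanCone A a := by
  rcases hv with rfl | ⟨x, ρ, hx, hxa, hρ, hlim⟩
  · left; simp
  · refine Or.inr ⟨x, fun n => r * ρ n, hx, hxa, fun n => mul_pos hr (hρ n), ?_⟩
    simpa only [mul_smul] using hlim.const_smul r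

/-- Federer's estimate on the distance of a chord from the tangent cone, up to the constant. -/
theorem exists_mem_tanCone_near_chord {d : ℕ} {A : Set (Euc d)} {R : ℝ} (hR : 0 < R)
    (H : ∀ x, infDist x A ≤ R → x ∈ unp A) {a b : Euc d} (ha : a ∈ A) (hb : b ∈ A) :
    ∃ v ∈ tanCone A a, ‖v - (b - a)‖ ≤ ‖b - a‖ ^ 2 / R := by
  rcases le_or_gt R ‖b - a‖ with hL | hL
  · refine ⟨0, Or.inl rfl, ?_⟩
    rw [zero_sub, norm_neg, le_div_iff₀ hR]
    nlinarith [norm_nonneg (b - a)]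
  rcases (norm_nonneg (b - a)).eq_or_lt with h0 | hpos
  · refine ⟨0, Or.inl rfl, ?_⟩
    rw [zero_sub, norm_neg, ← h0]
    simp
  have hsmall : ‖b - a‖ ^ 2 / R < ‖b - a‖ := by
    rw [div_lt_iff₀ hR]; nlinarith
  set t : ℕ → ℝ := fun n => 1 / ((n : ℝ) + 1) with ht
  have ht0 : ∀ n, 0 < t n := fun n => Nat.one_div_pos_of_nat
  have ht1 : ∀ n, t n ≤ 1 := fun n => by
    rw [ht]; exact (div_le_one (by positivity)).2 (by simp)
  have hex : ∀ n, ∃ q ∈ A, ‖a + t n • (b - a) - q‖ ≤ t n * ‖b - a‖ ^ 2 / R := fun n =>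
    exists_near_chord hR H ha hb (ht0 n).le (ht1 n)
      ((mul_le_of_le_one_left hpos.le (ht1 n)).trans_lt hL)
  choose q hqA hq using hex
  set w : ℕ → Euc d := fun n => (t n)⁻¹ • (q n - a) with hw
  have hqw : ∀ n, q n = a + t n • w n := fun n => by
    rw [hw]
    simp only
    rw [smul_inv_smul₀ (ht0 n).ne', add_sub_cancel]
  have hwb : ∀ n, w n ∈ closedBall (b - a) (‖b - a‖ ^ 2 / R) := fun n => by
    have h1 := hq n
    rw [hqw n, add_sub_add_left_eq_sub, ← smul_sub, norm_smul, Real.norm_of_nonneg (ht0 n).le,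
      mul_div_assoc] at h1
    rw [mem_closedBall, dist_comm, dist_eq_norm]
    exact le_of_mul_le_mul_left h1 (ht0 n)
  obtain ⟨v, hv, φ, hφ, hlim⟩ := (isCompact_closedBall _ _).tendsto_subseq hwb
  have htlim : Filter.Tendsto (t ∘ φ) Filter.atTop (nhds 0) :=
    tendsto_one_div_add_atTop_nhds_zero_nat.comp hφ.tendsto_atTop
  refine ⟨v, Or.inr ⟨q ∘ φ, fun n => (t (φ n))⁻¹, fun n => ⟨hqA _, fun h => ?_⟩, ?_,
    fun n => inv_pos.2 (ht0 _), hlim⟩, by rw [← dist_eq_norm]; exact hv⟩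
  · have h1 := hwb (φ n)
    have h2 : w (φ n) = 0 := by
      rw [hw]
      simp only [Function.comp_apply] at h ⊢
      rw [h, sub_self, smul_zero]
    rw [h2, mem_closedBall, dist_comm, dist_zero_right] at h1
    linarith
  · have h3 := (htlim.smul hlim).const_add a
    rw [zero_smul, add_zero] at h3
    refine h3.congr fun n => ?_
    simp only [Function.comp_apply]
    rw [hqw (φ n)]

/-- The tangent cone of a set of positive reach is lower semicontinuous. -/
theorem tanCone_lowerSemicontinuous {d : ℕ} {A : Set (Euc d)} {R : ℝ} (hR : 0 < R)
    (H : ∀ x, infDist x A ≤ R → x ∈ unp A) {x u : Euc d} (hu : u ∈ tanCone A x)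
    {ε : ℝ} (hε : 0 < ε) :
    ∀ᶠ y in nhds x, y ∈ A → ∃ v ∈ tanCone A y, ‖u - v‖ < ε := by
  rcases hu with rfl | ⟨z, r, hz, hzx, hr, hlim⟩
  · exact Filter.Eventually.of_forall fun y _ => ⟨0, Or.inl rfl, by simpa using hε⟩
  have hsub : Filter.Tendsto (fun n => z n - x) Filter.atTop (nhds 0) := by
    simpa using hzx.sub_const x
  have hsum : Filter.Tendsto
      (fun n => ‖r n • (z n - x) - u‖ + ‖r n • (z n - x)‖ * ‖z n - x‖ / R)
      Filter.atTop (nhds 0) := by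
    simpa using (hlim.sub_const u).norm.add ((hlim.norm.mul hsub.norm).div_const R)
  obtain ⟨n, hn⟩ := (hsum.eventually (gt_mem_nhds hε)).exists
  have hcont : ContinuousAt
      (fun y => ‖r n • (z n - y) - u‖ + ‖r n • (z n - y)‖ * ‖z n - y‖ / R) x := by fun_prop
  filter_upwards [hcont.eventually (gt_mem_nhds hn)] with y hy hyA
  obtain ⟨v, hv, hvz⟩ := exists_mem_tanCone_near_chord hR H hyA (hz n).1
  refine ⟨r n • v, smul_mem_tanCone_s12 hv (hr n), lt_of_le_of_lt ?_ hy⟩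
  have h1 : ‖r n • (v - (z n - y))‖ ≤ ‖r n • (z n - y)‖ * ‖z n - y‖ / R := by
    rw [norm_smul, norm_smul]
    calc ‖r n‖ * ‖v - (z n - y)‖ ≤ ‖r n‖ * (‖z n - y‖ ^ 2 / R) := by gcongr
      _ = _ := by ring
  calc ‖u - r n • v‖ = ‖(r n • (z n - y) - u) + r n • (v - (z n - y))‖ := by
        rw [← norm_neg]; congr 1; module
    _ ≤ _ := (norm_add_le _ _).trans (by gcongr)

theorem grassDist_le {d : ℕ} {U V : Submodule ℝ (Euc d)} {ε : ℝ} (hε : 0 ≤ ε)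
    (hU : ∀ u ∈ U, ‖u‖ = 1 → ∃ v ∈ V, ‖u - v‖ ≤ ε)
    (hV : ∀ v ∈ V, ‖v‖ = 1 → ∃ u ∈ U, ‖v - u‖ ≤ ε) : grassDist U V ≤ ε := by
  refine max_le (Real.sSup_le ?_ hε) (Real.sSup_le ?_ hε)
  · rintro _ ⟨u, ⟨hu, hu1⟩, rfl⟩
    obtain ⟨v, hv, huv⟩ := hU u hu hu1
    exact (infDist_le_dist_of_mem (s := (V : Set (Euc d))) hv).trans (by rwa [dist_eq_norm])
  · rintro _ ⟨v, ⟨hv, hv1⟩, rfl⟩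
    obtain ⟨u, hu, hvu⟩ := hV v hv hv1
    exact (infDist_le_dist_of_mem (s := (U : Set (Euc d))) hu).trans (by rwa [dist_eq_norm])

/-- Subspaces of the same dimension are close as soon as one of them contains a family close to
a fixed basis of the other. -/
theorem exists_grassDist_lt_of_basis_close {d k : ℕ} {b : Fin k → Euc d}
    (hb : LinearIndependent ℝ b) {ε : ℝ} (hε : 0 < ε) :
    ∃ η > (0 : ℝ), ∀ (v : Fin k → Euc d) (V : Submodule ℝ (Euc d)), (∀ i, v i ∈ V) →
      Module.finrank ℝ V = k → (∀ i, ‖b i - v i‖ < η) →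
      grassDist V (Submodule.span ℝ (range b)) < ε := by
  set T := Fintype.linearCombination ℝ b with hT
  obtain ⟨C, hC0, hC⟩ := T.exists_antilipschitzWith
    (LinearMap.ker_eq_bot.2 (hb.fintypeLinearCombination_injective))
  have hC0' : (0 : ℝ) < C := by exact_mod_cast hC0
  have hTb : ∀ c, ‖c‖ ≤ C * ‖T c‖ := fun c => by
    simpa using hC.le_mul_dist c 0
  set θ : ℝ := min (1 / (2 * C)) (ε / (4 * C)) with hθ
  have hθ0 : 0 < θ := by positivity
  have hθ1 : C * θ ≤ 1 / 2 := by
    calc C * θ ≤ C * (1 / (2 * C)) := by gcongr; exact min_le_left _ _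
      _ = 1 / 2 := by field_simp
  have hθ2 : 2 * C * θ ≤ ε / 2 := by
    calc 2 * C * θ ≤ 2 * C * (ε / (4 * C)) := by gcongr; exact min_le_right _ _
      _ = ε / 2 := by field_simp; norm_num
  refine ⟨θ / (k + 1), by positivity, fun v V hvV hV hbv => ?_⟩
  set S := Fintype.linearCombination ℝ v with hS
  have hTS : ∀ c, ‖T c - S c‖ ≤ θ * ‖c‖ := fun c => by
    rw [hT, hS, Fintype.linearCombination_apply, Fintype.linearCombination_apply,
      ← Finset.sum_sub_distrib]
    calc ‖∑ i, (c i • b i - c i • v i)‖ ≤ ∑ i : Fin k, ‖c‖ * (θ / (k + 1)) := by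
          refine norm_sum_le_of_le _ fun i _ => ?_
          rw [← smul_sub, norm_smul]
          exact mul_le_mul (norm_le_pi_norm c i) (hbv i).le (norm_nonneg _) (norm_nonneg _)
      _ = (k / (k + 1)) * (θ * ‖c‖) := by
          rw [Finset.sum_const, Finset.card_univ, Fintype.card_fin, nsmul_eq_mul]; ring
      _ ≤ 1 * (θ * ‖c‖) := by
          gcongr
          rw [div_le_one (by positivity)]; linarith
      _ = _ := one_mul _
  have hSb : ∀ c, ‖c‖ ≤ 2 * C * ‖S c‖ := fun c => by
    have h1 : ‖T c‖ ≤ ‖S c‖ + θ * ‖c‖ := by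
      have := norm_add_le (S c) (T c - S c)
      rw [add_sub_cancel] at this
      linarith [hTS c]
    have h2 := (hTb c).trans (mul_le_mul_of_nonneg_left h1 hC0'.le)
    have h3 := mul_le_mul_of_nonneg_right hθ1 (norm_nonneg c)
    nlinarith
  have hSinj : Function.Injective S := by
    rw [← LinearMap.ker_eq_bot, LinearMap.ker_eq_bot']
    intro c hc
    have := hSb c
    rw [hc, norm_zero, mul_zero] at this
    exact norm_le_zero_iff.1 this
  have hSle : LinearMap.range S ≤ V := by
    rw [hS, Fintype.range_linearCombination, Submodule.span_le]
    rintro _ ⟨i, rfl⟩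
    exact hvV i
  have hSV : LinearMap.range S = V := by
    refine Submodule.eq_of_le_of_finrank_eq hSle ?_
    rw [LinearMap.finrank_range_of_inj hSinj, hV, Module.finrank_fin_fun]
  have hTU : LinearMap.range T = Submodule.span ℝ (range b) := Fintype.range_linearCombination ℝ b
  refine (grassDist_le (ε := ε / 2) (by positivity) ?_ ?_).trans_lt (half_lt_self hε)
  · rw [← hSV, ← hTU]
    rintro _ ⟨c, rfl⟩ hc
    refine ⟨T c, ⟨c, rfl⟩, ?_⟩
    have h1 := hSb c
    rw [hc, mul_one] at h1
    rw [norm_sub_rev]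
    have := mul_le_mul_of_nonneg_left h1 hθ0.le
    linarith [hTS c]
  · rw [← hSV, ← hTU]
    rintro _ ⟨c, rfl⟩ hc
    refine ⟨S c, ⟨c, rfl⟩, ?_⟩
    have h1 := hTb c
    rw [hc, mul_one] at h1
    have := mul_le_mul_of_nonneg_left h1 hθ0.le
    have := mul_pos hC0' hθ0
    linarith [hTS c]

theorem exists_linearIndependent_fin {d k : ℕ} {s : Set (Euc d)}
    (hs : Module.finrank ℝ (Submodule.span ℝ s) = k) :
    ∃ b : Fin k → Euc d, (∀ i, b i ∈ s) ∧ LinearIndependent ℝ b ∧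
      Submodule.span ℝ (range b) = Submodule.span ℝ s := by
  obtain ⟨t, hts, hspan, hli⟩ := exists_linearIndependent ℝ s
  have : Fintype t := hli.setFinite.fintype
  have hcard : Fintype.card t = k := by
    rw [← hs, ← hspan, ← finrank_span_eq_card hli, Subtype.range_coe]
  set e := (Fintype.equivFinOfCardEq hcard).symm
  refine ⟨fun i => (e i : Euc d), fun i => hts (e i).2, hli.comp e e.injective, ?_⟩
  rw [show (fun i => (e i : Euc d)) = Subtype.val ∘ e from rfl, e.surjective.range_comp,
    Subtype.range_coe, hspan]

theorem stmt12 {d k : ℕ} (A : Set (Euc d)) (hA : 0 < reach A) (hk : 1 ≤ k) (hkd : k ≤ d) :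
    ∀ x ∈ Tk A k, ∀ ε > (0 : ℝ), ∃ δ > (0 : ℝ), ∀ y ∈ Tk A k, dist y x < δ →
      grassDist (Submodule.span ℝ (tanCone A y)) (Submodule.span ℝ (tanCone A x)) < ε := by
  rintro x ⟨hxA, hxk⟩ ε hε
  obtain ⟨R, hR, H⟩ := exists_pos_unp_of_reach_pos hA ⟨x, hxA⟩
  obtain ⟨b, hbx, hli, hspan⟩ := exists_linearIndependent_fin hxk
  obtain ⟨η, hη, hclose⟩ := exists_grassDist_lt_of_basis_close hli hε
  have hev : ∀ᶠ y in nhds x, ∀ i, y ∈ A → ∃ v ∈ tanCone A y, ‖b i - v‖ < η :=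
    Filter.eventually_all.2 fun i => tanCone_lowerSemicontinuous hR H (hbx i) hη
  obtain ⟨δ, hδ, hball⟩ := Metric.eventually_nhds_iff.1 hev
  refine ⟨δ, hδ, fun y hy hyx => ?_⟩
  choose v hv hbv using fun i => hball hyx i hy.1
  rw [← hspan]
  exact hclose v _ (fun i => Submodule.subset_span (hv i)) hy.2 hbv
end
end
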